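/- arXiv:1803.09777 — 3 statements merged into one kernel-verified Lean document; each statement's English description precedes it below -/
import Mathlib

section
/- The function d_T is a pseudometric on the set of 2×2 real symmetric positive definite matrices which vanishes exactly on conformal classes: for all such matrices A, B, C one has d_T(A,B) = d_T(B,A), d_T(A,C) ≤ d_T(A,B) + d_T(B,C), and d_T(A,B) = 0 if and only if B = s·A for some real s > 0. -/
/-- The Teichmüller distance between two `2×2` real symmetric positive definite
matrices: `d_T(A,B) = (1/4)·log(λ_max(A⁻¹B)/λ_min(A⁻¹B))`, where the (real,
positive) eigenvalues of `A⁻¹B` form the real spectrum of `A⁻¹B`. -/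
noncomputable def dT (A B : Matrix (Fin 2) (Fin 2) ℝ) : ℝ :=
  (1 / 4) * Real.log (sSup (spectrum ℝ (A⁻¹ * B)) / sInf (spectrum ℝ (A⁻¹ * B)))

open scoped MatrixOrder ComplexOrder in
theorem aux_factor (A : Matrix (Fin 2) (Fin 2) ℝ) (hA : A.PosDef) :
    ∃ S : Matrix (Fin 2) (Fin 2) ℝ, A = S.transpose * S := by
  obtain ⟨y, hy⟩ := CStarAlgebra.nonneg_iff_eq_star_mul_self.mp hA.posSemidef.nonneg
  exact ⟨y, by rw [hy, Matrix.star_eq_conjTranspose, Matrix.conjTranspose_eq_transpose_of_trivial]⟩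

theorem aux_diag (A B : Matrix (Fin 2) (Fin 2) ℝ) (hA : A.PosDef) (hB : B.PosDef) :
    ∃ (P Q : Matrix (Fin 2) (Fin 2) ℝ) (d : Fin 2 → ℝ), P * Q = 1 ∧ Q * P = 1 ∧
      P.transpose * A * P = 1 ∧ P.transpose * B * P = Matrix.diagonal d := by
  obtain ⟨S, hS⟩ := aux_factor A hA
  have hdet : IsUnit S.det := by
    have h := hA.det_pos
    rw [hS, Matrix.det_mul, Matrix.det_transpose] at h
    exact isUnit_iff_ne_zero.mpr (fun h0 => by simp [h0] at h)
  have h1 : S * S⁻¹ = 1 := Matrix.mul_nonsing_inv S hdet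
  have h2 : S⁻¹ * S = 1 := Matrix.nonsing_inv_mul S hdet
  have h1t : (S⁻¹).transpose * S.transpose = 1 := by
    rw [← Matrix.transpose_mul, h1, Matrix.transpose_one]
  set T := S⁻¹ with hT
  have hH : (T.conjTranspose * B * T).IsHermitian :=
    Matrix.isHermitian_conjTranspose_mul_mul T hB.1
  have hspec := hH.conjStarAlgAut_star_eigenvectorUnitary
  rw [Unitary.conjStarAlgAut_star_apply] at hspec
  have hu1 : star (hH.eigenvectorUnitary : Matrix (Fin 2) (Fin 2) ℝ) * hH.eigenvectorUnitary = 1 :=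
    Unitary.coe_star_mul_self _
  have hu2 : (hH.eigenvectorUnitary : Matrix (Fin 2) (Fin 2) ℝ) * star
      (hH.eigenvectorUnitary : Matrix (Fin 2) (Fin 2) ℝ) = 1 :=
    Unitary.coe_mul_star_self _
  set U : Matrix (Fin 2) (Fin 2) ℝ := (hH.eigenvectorUnitary).1 with hU
  rw [Matrix.star_eq_conjTranspose, Matrix.conjTranspose_eq_transpose_of_trivial] at hspec hu1 hu2
  generalize hH.eigenvalues = d at hspec
  rw [Matrix.conjTranspose_eq_transpose_of_trivial] at hspec
  refine ⟨T * U, U.transpose * S, d, ?_, ?_, ?_, ?_⟩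
  · rw [Matrix.mul_assoc, ← Matrix.mul_assoc U, hu2, Matrix.one_mul, h2]
  · rw [Matrix.mul_assoc, ← Matrix.mul_assoc S, h1, Matrix.one_mul, hu1]
  · calc (T * U).transpose * A * (T * U)
        = U.transpose * ((T.transpose * S.transpose) * (S * T)) * U := by
          rw [hS, Matrix.transpose_mul]; simp only [Matrix.mul_assoc]
      _ = 1 := by rw [h1t, h1, Matrix.one_mul, Matrix.mul_one, hu1]
  · rw [Matrix.transpose_mul]
    simp only [Matrix.mul_assoc] at hspec ⊢
    exact hspec

/-- The quadratic form of a matrix. -/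
noncomputable def qf (A : Matrix (Fin 2) (Fin 2) ℝ) (x : Fin 2 → ℝ) : ℝ := x ⬝ᵥ (A.mulVec x)

theorem qf_pos (A : Matrix (Fin 2) (Fin 2) ℝ) (hA : A.PosDef) (x : Fin 2 → ℝ) (hx : x ≠ 0) :
    0 < qf A x := by
  have := hA.dotProduct_mulVec_pos hx
  simpa [qf] using this

theorem qf_conj (A P : Matrix (Fin 2) (Fin 2) ℝ) (y : Fin 2 → ℝ) :
    qf A (P.mulVec y) = qf (P.transpose * A * P) y := by
  simp only [qf, ← Matrix.mulVec_mulVec]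
  rw [Matrix.dotProduct_mulVec y, Matrix.vecMul_transpose]

theorem qf_diagonal (d y : Fin 2 → ℝ) :
    qf (Matrix.diagonal d) y = d 0 * y 0 ^ 2 + d 1 * y 1 ^ 2 := by
  simp [qf, Matrix.mulVec_diagonal, dotProduct, Fin.sum_univ_two]; ring

theorem qf_one (y : Fin 2 → ℝ) : qf 1 y = y 0 ^ 2 + y 1 ^ 2 := by
  rw [← Matrix.diagonal_one, qf_diagonal]; ring

theorem aux_spectrum (A B P Q : Matrix (Fin 2) (Fin 2) ℝ) (d : Fin 2 → ℝ)
    (hPQ : P * Q = 1) (hQP : Q * P = 1) (hA : P.transpose * A * P = 1)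
    (hB : P.transpose * B * P = Matrix.diagonal d) :
    spectrum ℝ (A⁻¹ * B) = {d 0, d 1} := by
  have hinv : A⁻¹ = P * P.transpose := by
    apply Matrix.inv_eq_left_inv
    calc P * P.transpose * A = P * (P.transpose * A * P) * Q := by
          simp only [Matrix.mul_assoc]; rw [hPQ, Matrix.mul_one]
      _ = 1 := by rw [hA, Matrix.mul_one, hPQ]
  let u : (Matrix (Fin 2) (Fin 2) ℝ)ˣ := ⟨P, Q, hPQ, hQP⟩
  have : A⁻¹ * B = u * Matrix.diagonal d * ((u⁻¹ : (Matrix (Fin 2) (Fin 2) ℝ)ˣ) :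
      Matrix (Fin 2) (Fin 2) ℝ) := by
    change A⁻¹ * B = P * Matrix.diagonal d * Q
    rw [hinv, ← hB]
    simp only [Matrix.mul_assoc]; rw [hPQ, Matrix.mul_one]
  rw [this, spectrum.units_conjugate, spectrum_diagonal]
  ext x; simp [Fin.exists_fin_two, eq_comm]

theorem aux_key (A B : Matrix (Fin 2) (Fin 2) ℝ) (hA : A.PosDef) (hB : B.PosDef) :
    ∃ m M : ℝ, 0 < m ∧ m ≤ M ∧ dT A B = (1 / 4) * Real.log (M / m) ∧
      (∀ x, m * qf A x ≤ qf B x) ∧ (∀ x, qf B x ≤ M * qf A x) ∧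
      (∃ x, x ≠ 0 ∧ qf B x = m * qf A x) ∧ (∃ x, x ≠ 0 ∧ qf B x = M * qf A x) := by
  obtain ⟨P, Q, d, hPQ, hQP, hPA, hPB⟩ := aux_diag A B hA hB
  have hqA : ∀ y, qf A (P.mulVec y) = y 0 ^ 2 + y 1 ^ 2 := fun y => by
    rw [qf_conj, hPA, qf_one]
  have hqB : ∀ y, qf B (P.mulVec y) = d 0 * y 0 ^ 2 + d 1 * y 1 ^ 2 := fun y => by
    rw [qf_conj, hPB, qf_diagonal]
  have hsurj : ∀ x, P.mulVec (Q.mulVec x) = x := fun x => by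
    rw [Matrix.mulVec_mulVec, hPQ, Matrix.one_mulVec]
  have hne : ∀ y : Fin 2 → ℝ, y ≠ 0 → P.mulVec y ≠ 0 := fun y hy h => hy (by
    have : Q.mulVec (P.mulVec y) = y := by rw [Matrix.mulVec_mulVec, hQP, Matrix.one_mulVec]
    rw [← this, h, Matrix.mulVec_zero])
  have hatt : ∀ i, ∃ x, x ≠ 0 ∧ qf B x = d i * qf A x := fun i => by
    refine ⟨P.mulVec (Pi.single i 1), hne _ (by simp), ?_⟩
    rw [hqA, hqB]
    fin_cases i <;> simp
  have hd : ∀ i, 0 < d i := fun i => by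
    obtain ⟨x, hx, h⟩ := hatt i
    have h1 := qf_pos A hA x hx
    have h2 := qf_pos B hB x hx
    rw [h] at h2
    exact (pos_iff_pos_of_mul_pos h2).mpr h1
  have hdT : dT A B = (1 / 4) * Real.log (max (d 0) (d 1) / min (d 0) (d 1)) := by
    rw [dT, aux_spectrum A B P Q d hPQ hQP hPA hPB, csSup_pair, csInf_pair]
  refine ⟨min (d 0) (d 1), max (d 0) (d 1), lt_min (hd 0) (hd 1), min_le_max, hdT, ?_, ?_, ?_, ?_⟩
  · intro x
    rw [← hsurj x, hqA, hqB, mul_add]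
    gcongr
    · exact min_le_left _ _
    · exact min_le_right _ _
  · intro x
    rw [← hsurj x, hqA, hqB, mul_add]
    gcongr
    · exact le_max_left _ _
    · exact le_max_right _ _
  · rcases min_choice (d 0) (d 1) with h | h <;> rw [h]
    exacts [hatt 0, hatt 1]
  · rcases max_choice (d 0) (d 1) with h | h <;> rw [h]
    exacts [hatt 0, hatt 1]

theorem aux_eq (A B : Matrix (Fin 2) (Fin 2) ℝ) (hA : A.PosDef) (hB : B.PosDef) (s : ℝ)
    (h : ∀ x, qf B x = s * qf A x) : B = s • A := by
  have hA1 : A 1 0 = A 0 1 := by simpa using hA.1.apply 0 1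
  have hB1 : B 1 0 = B 0 1 := by simpa using hB.1.apply 0 1
  have e0 := h ![1, 0]
  have e1 := h ![0, 1]
  have e2 := h ![1, 1]
  simp [qf, dotProduct, Matrix.mulVec, Fin.sum_univ_two] at e0 e1 e2
  rw [hA1, hB1] at e2
  ext i j
  fin_cases i <;> fin_cases j <;> simp <;> (try rw [hA1, hB1]) <;> nlinarith

/-- `d_T` is a pseudometric on the `2×2` real symmetric positive definite matrices
which vanishes exactly on conformal classes: it is symmetric, satisfies the
triangle inequality, and `d_T(A,B) = 0` iff `B` is a positive scalar multiple
of `A`. -/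
theorem stmt6 (A B C : Matrix (Fin 2) (Fin 2) ℝ)
    (hA : A.PosDef) (hB : B.PosDef) (hC : C.PosDef) :
    dT A B = dT B A ∧
    dT A C ≤ dT A B + dT B C ∧
    (dT A B = 0 ↔ ∃ s : ℝ, 0 < s ∧ B = s • A) := by
  obtain ⟨m, M, hm, hmM, hd, hlo, hhi, ⟨w, hw, ew⟩, ⟨u, hu, eu⟩⟩ := aux_key A B hA hB
  have hM : 0 < M := hm.trans_le hmM
  refine ⟨?_, ?_, ?_⟩
  · obtain ⟨m', M', hm', hmM', hd', hlo', hhi', ⟨w', hw', ew'⟩, ⟨u', hu', eu'⟩⟩ :=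
      aux_key B A hB hA
    have hM' : 0 < M' := hm'.trans_le hmM'
    have h1 : m * M' = 1 := by
      apply le_antisymm
      · have h := hlo u'
        rw [eu'] at h
        have hp := qf_pos B hB u' hu'
        exact le_of_mul_le_mul_right (by linarith) hp
      · have h := hhi' w
        rw [ew] at h
        have hp := qf_pos A hA w hw
        exact le_of_mul_le_mul_right (by linarith) hp
    have h2 : m' * M = 1 := by
      apply le_antisymm
      · have h := hlo' u
        rw [eu] at h
        have hp := qf_pos A hA u hu
        exact le_of_mul_le_mul_right (by linarith) hp
      · have h := hhi w'
        rw [ew'] at h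
        have hp := qf_pos B hB w' hw'
        exact le_of_mul_le_mul_right (by linarith) hp
    have h3 : M / m = M' / m' := by
      rw [div_eq_div_iff hm.ne' hm'.ne']; linarith
    rw [hd, hd', h3]
  · obtain ⟨m', M', hm', hmM', hd', hlo', hhi', -, -⟩ := aux_key B C hB hC
    obtain ⟨n, N, hn, hnN, hd'', -, -, ⟨z, hz, ez⟩, ⟨v, hv, ev⟩⟩ := aux_key A C hA hC
    have hM' : 0 < M' := hm'.trans_le hmM'
    have hN : 0 < N := hn.trans_le hnN
    have h1 : N ≤ M' * M := by
      have hp := qf_pos A hA v hv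
      have h := hhi' v
      have h' := mul_le_mul_of_nonneg_left (hhi v) hM'.le
      exact le_of_mul_le_mul_right (by linarith) hp
    have h2 : m' * m ≤ n := by
      have hp := qf_pos A hA z hz
      have h := hlo' z
      have h' := mul_le_mul_of_nonneg_left (hlo z) hm'.le
      exact le_of_mul_le_mul_right (by linarith) hp
    have h3 : Real.log (N / n) ≤ Real.log (M / m) + Real.log (M' / m') := by
      rw [← Real.log_mul (by positivity) (by positivity)]
      apply Real.log_le_log (by positivity)
      rw [div_mul_div_comm, mul_comm M, mul_comm m]
      exact div_le_div₀ (by positivity) h1 (by positivity) h2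
    rw [hd, hd', hd'']
    linarith
  · constructor
    · intro h0
      refine ⟨m, hm, aux_eq A B hA hB m fun x => ?_⟩
      have hl : Real.log (M / m) = 0 := by linarith
      have h1 : M / m = 1 := Real.eq_one_of_pos_of_log_eq_zero (by positivity) hl
      have h2 : M = m := by rwa [div_eq_one_iff_eq hm.ne'] at h1
      exact le_antisymm (h2 ▸ hhi x) (hlo x)
    · rintro ⟨s, hs, rfl⟩
      have hq : ∀ x, qf (s • A) x = s * qf A x := fun x => by
        simp [qf, Matrix.smul_mulVec]; ring
      rw [hq] at ew eu
      have h1 := mul_right_cancel₀ (qf_pos A hA w hw).ne' ew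
      have h2 := mul_right_cancel₀ (qf_pos A hA u hu).ne' eu
      rw [hd, ← h1, ← h2, div_self hs.ne', Real.log_one, mul_zero]
end

section
/- Let V be a finite-dimensional real vector space, W ⊆ V a linear subspace of codimension 1, t ↦ g_t a family of inner products on V differentiable at 0 with strain η, and t ↦ n_t a map ℝ → V differentiable at 0 such that g_t(n_t, n_t) = 1 and g_t(w, n_t) = 0 for all w ∈ W and all t. Then the derivative ṅ of n_t at t = 0 satisfies √(g₀(ṅ, ṅ)) ≤ 3·‖η‖. -/
theorem aux_bdd {V : Type*} [NormedAddCommGroup V] [NormedSpace ℝ V]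
    [FiniteDimensional ℝ V] (B : V →L[ℝ] V →L[ℝ] ℝ)
    (hpos : ∀ x : V, x ≠ 0 → 0 < B x x) (η : V →L[ℝ] V) (N : V) (hN : N ≠ 0) :
    BddAbove {r : ℝ | ∃ x : V, B x x = 1 ∧ r = Real.sqrt (B (η x) (η x))} := by
  have : Nontrivial V := ⟨N, 0, hN⟩
  have : ProperSpace V := FiniteDimensional.proper ℝ V
  obtain ⟨x0, hx0, hmin⟩ := (isCompact_sphere (0 : V) 1).exists_isMinOn
    (NormedSpace.sphere_nonempty.2 zero_le_one)
    (f := fun x => B x x) (by fun_prop)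
  have hx0' : x0 ≠ 0 := by
    rintro rfl
    simp at hx0
  have hc : 0 < B x0 x0 := hpos x0 hx0'
  have key : ∀ x : V, B x0 x0 * ‖x‖ ^ 2 ≤ B x x := by
    intro x
    by_cases hx : x = 0
    · simp [hx]
    have hnx : 0 < ‖x‖ := norm_pos_iff.2 hx
    have h1 : (‖x‖⁻¹ • x) ∈ Metric.sphere (0 : V) 1 := by
      simp [norm_smul, hnx.ne']
    have h2 : B x0 x0 ≤ B (‖x‖⁻¹ • x) (‖x‖⁻¹ • x) := hmin h1
    simp only [map_smul, ContinuousLinearMap.smul_apply, smul_eq_mul] at h2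
    calc B x0 x0 * ‖x‖ ^ 2 ≤ (‖x‖⁻¹ * (‖x‖⁻¹ * B x x)) * ‖x‖ ^ 2 := by gcongr
      _ = B x x := by field_simp
  refine ⟨Real.sqrt (‖B‖ * ‖η‖ ^ 2 / B x0 x0), ?_⟩
  rintro r ⟨x, hx, rfl⟩
  apply Real.sqrt_le_sqrt
  have h3 := key x
  rw [hx] at h3
  have h4 : B (η x) (η x) ≤ ‖B‖ * ‖η x‖ * ‖η x‖ :=
    (le_abs_self _).trans (B.le_opNorm₂ (η x) (η x))
  have h5 := η.le_opNorm x
  rw [le_div_iff₀ hc]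
  calc B (η x) (η x) * B x0 x0 ≤ (‖B‖ * (‖η‖ * ‖x‖) * (‖η‖ * ‖x‖)) * B x0 x0 := by
        gcongr
        exact h4.trans (by gcongr)
    _ = ‖B‖ * ‖η‖ ^ 2 * (B x0 x0 * ‖x‖ ^ 2) := by ring
    _ ≤ ‖B‖ * ‖η‖ ^ 2 * 1 := by gcongr
    _ = _ := by ring

/-- Let `V` be a finite-dimensional real vector space, `W ⊆ V` a subspace of
codimension 1, `t ↦ g t` a family of inner products (symmetric positive
definite bilinear forms) differentiable at `0` with strain `η` (the
`g 0`-self-adjoint endomorphism with `(d/dt)|₀ g t x y = 2·g 0 (η x) y`), and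
`t ↦ n t` a differentiable unit normal family: `g t (n t) (n t) = 1` and
`g t w (n t) = 0` for all `w ∈ W`, `t`. Then the derivative `ṅ` at `0`
satisfies `√(g 0 ṅ ṅ) ≤ 3·‖η‖`, where
`‖η‖ = sup{√(g 0 (η x) (η x)) : g 0 x x = 1}`. -/
theorem stmt12 {V : Type*} [NormedAddCommGroup V] [NormedSpace ℝ V]
    [FiniteDimensional ℝ V]
    (W : Submodule ℝ V) (hW : Module.finrank ℝ (V ⧸ W) = 1)
    (g : ℝ → (V →L[ℝ] V →L[ℝ] ℝ)) (G : V →L[ℝ] V →L[ℝ] ℝ)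
    (hsymm : ∀ (t : ℝ) (x y : V), g t x y = g t y x)
    (hposdef : ∀ (t : ℝ) (x : V), x ≠ 0 → 0 < g t x x)
    (hg : HasDerivAt g G 0)
    (η : V →L[ℝ] V)
    (hη_selfadj : ∀ x y : V, g 0 (η x) y = g 0 x (η y))
    (hstrain : ∀ x y : V, G x y = 2 * g 0 (η x) y)
    (n : ℝ → V) (ndot : V) (hn : HasDerivAt n ndot 0)
    (hunit : ∀ t : ℝ, g t (n t) (n t) = 1)
    (horth : ∀ t : ℝ, ∀ w ∈ W, g t w (n t) = 0) :
    Real.sqrt (g 0 ndot ndot) ≤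
      3 * sSup {r : ℝ | ∃ x : V, g 0 x x = 1 ∧ r = Real.sqrt (g 0 (η x) (η x))} := by
  have hN0 : n 0 ≠ 0 := by
    intro h
    have := hunit 0
    simp [h] at this
  have hbdd := aux_bdd (g 0) (hposdef 0) η (n 0) hN0
  have hle := le_csSup hbdd ⟨n 0, hunit 0, rfl⟩
  have d1 : G (n 0) (n 0) + g 0 ndot (n 0) + g 0 (n 0) ndot = 0 := by
    have h := (hg.clm_apply hn).clm_apply hn
    have h2 : HasDerivAt (fun t => g t (n t) (n t)) 0 0 := by
      simp only [hunit]
      exact hasDerivAt_const _ _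
    simpa using h.unique h2
  have d2 : ∀ w ∈ W, G w (n 0) + g 0 w ndot = 0 := by
    intro w hw
    have h := (hg.clm_apply (hasDerivAt_const (0 : ℝ) w)).clm_apply hn
    have h2 : HasDerivAt (fun t => g t w (n t)) 0 0 := by
      simp only [horth _ w hw]
      exact hasDerivAt_const _ _
    simpa using h.unique h2
  generalize hN : n 0 = N at *
  have hNN : g 0 N N = 1 := by rw [← hN]; exact hunit 0
  have hWN : ∀ w ∈ W, g 0 w N = 0 := by rw [← hN]; exact horth 0
  have hNW : N ∉ W := by
    intro h
    have := hWN N h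
    linarith
  rw [hstrain, hsymm 0 N ndot] at d1
  have hu : ndot + (2 : ℝ) • η N - (g 0 (η N) N) • N = 0 := by
    by_contra hne
    have hp := hposdef 0 _ hne
    generalize hu : ndot + (2 : ℝ) • η N - (g 0 (η N) N) • N = u at *
    have huN : g 0 u N = 0 := by
      rw [← hu]
      simp
      rw [hNN]
      linarith
    have huW : ∀ w ∈ W, g 0 u w = 0 := by
      intro w hw
      rw [hsymm, ← hu]
      have h1 := d2 w hw
      rw [hstrain, hη_selfadj] at h1
      simp
      rw [hWN w hw]
      linarith
    obtain ⟨c, hc⟩ := exists_smul_eq_of_finrank_eq_one hW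
      (x := W.mkQ N) (by simpa using hNW) (W.mkQ u)
    have hm : u - c • N ∈ W := by
      rw [← Submodule.ker_mkQ W, LinearMap.mem_ker, map_sub, map_smul, hc, sub_self]
    have h1 := huW _ hm
    simp [huN] at h1
    linarith
  have hd : ndot = (g 0 (η N) N) • N - (2 : ℝ) • η N := by
    rw [eq_sub_iff_add_eq, ← sub_eq_zero]; exact hu
  have hnn : g 0 ndot ndot = 4 * g 0 (η N) (η N) - 3 * (g 0 (η N) N) ^ 2 := by
    rw [hd]
    simp
    rw [hNN, hsymm 0 N (η N)]
    ring
  have hS : 0 ≤ Real.sqrt (g 0 (η N) (η N)) := Real.sqrt_nonneg _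
  have : Real.sqrt (g 0 ndot ndot) ≤ 2 * Real.sqrt (g 0 (η N) (η N)) := by
    rw [show (2 : ℝ) = Real.sqrt (2 ^ 2) by simp, ← Real.sqrt_mul (by norm_num)]
    apply Real.sqrt_le_sqrt
    rw [hnn]
    nlinarith [sq_nonneg (g 0 (η N) N)]
  linarith
end

section
/- Let C, D, ε > 0 and t₁ ≥ 0, and let f : [0,∞) → (0,∞) be continuous. Assume: (i) f(s) ≥ ε for every s ∈ [0, t₁]; and (ii) for every t ≥ t₁ with f(t) ≤ ε and every s ∈ [0,1], one has |log f(t+s) − log f(t)| ≤ C·exp(−D·t). Then f(t) ≥ ε·exp(−C·exp(−D·t₁)/(1 − exp(−D))) for every t ≥ 0. (This is the summation argument showing that quantities satisfying the inflexibility estimate, such as lengths of peripheral geodesics, never become shorter than a definite constant.) -/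
/-- The summation argument showing that quantities satisfying the inflexibility
estimate never become shorter than a definite constant: if `f : [0,∞) → (0,∞)`
is continuous, `f ≥ ε` on `[0,t₁]`, and whenever `t ≥ t₁` and `f t ≤ ε` one has
`|log f(t+s) − log f(t)| ≤ C·exp(−D·t)` for all `s ∈ [0,1]`, then
`f(t) ≥ ε·exp(−C·exp(−D·t₁)/(1 − exp(−D)))` for all `t ≥ 0`. -/
theorem stmt13 (C D ε t₁ : ℝ) (hC : 0 < C) (hD : 0 < D) (hε : 0 < ε) (ht₁ : 0 ≤ t₁)
    (f : ℝ → ℝ) (hfpos : ∀ t : ℝ, 0 ≤ t → 0 < f t)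
    (hfcont : ContinuousOn f (Set.Ici (0 : ℝ)))
    (hinit : ∀ s : ℝ, 0 ≤ s → s ≤ t₁ → ε ≤ f s)
    (hinflex : ∀ t : ℝ, t₁ ≤ t → f t ≤ ε → ∀ s : ℝ, 0 ≤ s → s ≤ 1 →
      |Real.log (f (t + s)) - Real.log (f t)| ≤ C * Real.exp (-D * t)) :
    ∀ t : ℝ, 0 ≤ t →
      ε * Real.exp (-(C * Real.exp (-D * t₁)) / (1 - Real.exp (-D))) ≤ f t := by
  intro t ht
  set q := Real.exp (-D) with hq
  have hq0 : 0 < q := Real.exp_pos _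
  have hq1 : q < 1 := by rw [hq]; exact Real.exp_lt_one_iff.mpr (by linarith)
  have h1q : 0 < 1 - q := by linarith
  have hS : -(C * Real.exp (-D * t₁)) / (1 - q) ≤ 0 := by
    apply div_nonpos_of_nonpos_of_nonneg _ h1q.le
    have := Real.exp_pos (-D * t₁)
    nlinarith
  by_cases hft : ε ≤ f t
  · have h1 := Real.exp_le_one_iff.mpr hS
    nlinarith
  push Not at hft
  have htt : t₁ < t := by
    by_contra h
    push Not at h
    exact absurd (hinit t ht h) (not_le.mpr hft)
  have hcont : ContinuousOn f (Set.Icc 0 t) := hfcont.mono Set.Icc_subset_Ici_self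
  have hcl : IsClosed (Set.Icc 0 t ∩ f ⁻¹' Set.Ici ε) :=
    hcont.preimage_isClosed_of_isClosed isClosed_Icc isClosed_Ici
  have hcomp : IsCompact (Set.Icc 0 t ∩ f ⁻¹' Set.Ici ε) :=
    isCompact_Icc.of_isClosed_subset hcl Set.inter_subset_left
  obtain ⟨a, ⟨⟨ha0, hat⟩, hfa⟩, hub⟩ := hcomp.exists_isGreatest
    ⟨t₁, ⟨ht₁, htt.le⟩, hinit t₁ ht₁ le_rfl⟩
  have hta : t₁ ≤ a := hub ⟨⟨ht₁, htt.le⟩, hinit t₁ ht₁ le_rfl⟩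
  have hfa' : ε ≤ f a := hfa
  have hfaε : f a = ε := by
    obtain ⟨c, ⟨hc1, hc2⟩, hc⟩ := intermediate_value_Icc' hat
      (hcont.mono (Set.Icc_subset_Icc_left ha0)) ⟨hft.le, hfa'⟩
    have : c ≤ a := hub ⟨⟨by linarith, hc2⟩, hc.ge⟩
    have : c = a := le_antisymm this hc1
    rw [← this, hc]
  have hle : ∀ x, a ≤ x → x ≤ t → f x ≤ ε := by
    intro x hx hxt
    by_contra h
    push Not at h
    have h2 : x ≤ a := hub ⟨⟨by linarith, hxt⟩, h.le⟩
    have : x = a := le_antisymm h2 hx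
    rw [this, hfaε] at h
    exact lt_irrefl _ h
  have key : ∀ n : ℕ, ∀ u : ℝ, 0 ≤ u → u ≤ n → a + u ≤ t →
      Real.log ε - C * Real.exp (-D * a) * ((1 - q ^ n) / (1 - q)) ≤ Real.log (f (a + u)) := by
    intro n
    induction n with
    | zero =>
      intro u h0 h1 _
      have : u = 0 := le_antisymm (by simpa using h1) h0
      simp [this, hfaε]
    | succ n ih =>
      intro u h0 h1 h2
      have hstep : (1 - q ^ (n + 1)) / (1 - q) = (1 - q ^ n) / (1 - q) + q ^ n := by
        field_simp
        ring
      have hpos : 0 < C * Real.exp (-D * a) * q ^ n := by positivity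
      rw [hstep, mul_add]
      by_cases hu : u ≤ n
      · have := ih u h0 hu h2
        linarith
      push Not at hu
      push_cast at h1
      have hn0 : (0 : ℝ) ≤ n := Nat.cast_nonneg n
      have h3 := ih n hn0 le_rfl (by linarith)
      have h4 := hinflex (a + n) (by linarith) (hle _ (by linarith) (by linarith)) (u - n)
        (by linarith) (by linarith)
      have h5 : Real.exp (-D * (a + n)) = Real.exp (-D * a) * q ^ n := by
        rw [hq, ← Real.exp_nat_mul, ← Real.exp_add]
        congr 1
        ring
      rw [h5, show a + n + (u - n) = a + u by ring] at h4
      have h6 := (abs_le.mp h4).1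
      linarith
  obtain ⟨n, hn⟩ := exists_nat_ge (t - a)
  have h := key n (t - a) (by linarith) hn (by linarith)
  rw [show a + (t - a) = t by ring] at h
  have hb : C * Real.exp (-D * a) * ((1 - q ^ n) / (1 - q))
      ≤ C * Real.exp (-D * t₁) * (1 / (1 - q)) := by
    have e1 : Real.exp (-D * a) ≤ Real.exp (-D * t₁) := Real.exp_le_exp.mpr (by nlinarith)
    have e2 : 0 ≤ 1 - q ^ n := sub_nonneg.mpr (pow_le_one₀ hq0.le hq1.le)
    have e3 : 1 - q ^ n ≤ 1 := by have := pow_pos hq0 n; linarith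
    gcongr
  have hft0 := hfpos t ht
  rw [← Real.log_le_log_iff (by positivity) hft0, Real.log_mul hε.ne' (Real.exp_pos _).ne',
    Real.log_exp]
  have : -(C * Real.exp (-D * t₁)) / (1 - q) = -(C * Real.exp (-D * t₁) * (1 / (1 - q))) := by ring
  rw [this]
  linarith
end
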